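/- arXiv:2503.08868 — 3 statements merged into one kernel-verified Lean document; each statement's English description precedes it below -/
import Mathlib

section
/- Fix integers m, n ≥ 1 and set p = m + n. Then the set B₀(m,n) := B(m,n) ∩ S_p = {(a,v) ∈ ℂ² : F_{a,v}^{∘m}(a) = −a, F_{a,v}^{∘n}(−a) = a, and a has exact period p under F_{a,v}} is finite and has exactly d(p) elements. -/
open Function Set

/-- The monic centered cubic polynomial `F_{a,v}(z) = z³ − 3a²z + (2a³ + v)`. -/
noncomputable def Fav (a v : ℂ) : ℂ → ℂ := fun z => z ^ 3 - 3 * a ^ 2 * z + (2 * a ^ 3 + v)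

/-- `z` has exact period `p ≥ 1` under `F`. -/
def HasExactPeriod (F : ℂ → ℂ) (z : ℂ) (p : ℕ) : Prop :=
  F^[p] z = z ∧ ∀ j, 0 < j → j < p → F^[j] z ≠ z

section PlaneIntersection

open MvPolynomial MonomialOrder

variable {K : Type*} [Field K] {mo : MonomialOrder (Fin 2)} {f g : MvPolynomial (Fin 2) K}
  {M N : ℕ}

/-- Exponents of the monomials `X₀ ^ i * X₁ ^ j` with `i < M` and `j < N`. -/
def exponentBox (M N : ℕ) : Set (Fin 2 →₀ ℕ) := {s | s 0 < M ∧ s 1 < N}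

/-- The exponents in the box are the pairs in `Fin M × Fin N`. -/
noncomputable def exponentBoxEquiv (M N : ℕ) : exponentBox M N ≃ Fin M × Fin N where
  toFun s := (⟨s.1 0, s.2.1⟩, ⟨s.1 1, s.2.2⟩)
  invFun q := ⟨Finsupp.equivFunOnFinite.symm ![q.1, q.2], by simp [exponentBox]⟩
  left_inv s := by
    ext i
    fin_cases i <;> simp
  right_inv q := by ext <;> simp

theorem eq_zero_of_mem_span_of_mem_restrictSupport (hf : mo.degree f = Finsupp.single 0 M)
    (hg : mo.degree g = Finsupp.single 1 N) (hf0 : f ≠ 0) (hg0 : g ≠ 0)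
    {p : MvPolynomial (Fin 2) K} (hp : p ∈ Ideal.span {f, g})
    (hbox : p ∈ restrictSupport K (exponentBox M N)) : p = 0 := by
  obtain ⟨q, r, rfl⟩ := Ideal.mem_span_pair.1 hp
  obtain ⟨h, r', rfl, -, hr'⟩ := mo.div_single (b := f) (by simpa using hf0) r
  by_contra hne
  have hmem := (mem_restrictSupport_iff (R := K)).1 hbox (mo.degree_mem_support hne)
  have hsum : q * f + (h * f + r') * g = (q + h * g) * f + r' * g := by ring
  rw [hsum] at hmem hne
  set q' := q + h * g
  have hq : q' ≠ 0 → mo.degree (q' * f) = mo.degree q' + Finsupp.single 0 M := fun h0 => by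
    rw [mo.degree_mul h0 hf0, hf]
  have hr : r' ≠ 0 → mo.degree (r' * g) = mo.degree r' + Finsupp.single 1 N := fun h0 => by
    rw [mo.degree_mul h0 hg0, hg]
  obtain ⟨h1, h2⟩ := hmem
  by_cases hq0 : q' = 0
  · have hr0 : r' ≠ 0 := by
      rintro h0
      simp [hq0, h0] at hne
    simp [hq0, hr hr0] at h2
  by_cases hr0 : r' = 0
  · simp [hr0, hq hq0] at h1
  have hr1 : mo.degree r' 0 < M := by
    have := hr' _ (mo.degree_mem_support hr0)
    rwa [hf, Finsupp.single_le_iff, not_le] at this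
  have hd : mo.degree (q' * f) ≠ mo.degree (r' * g) := by
    rw [hq hq0, hr hr0]
    intro h
    have := DFunLike.congr_fun h 0
    simp at this
    omega
  have := mo.degree_add_of_ne hd
  rcases max_choice (mo.toSyn (mo.degree (q' * f))) (mo.toSyn (mo.degree (r' * g))) with h | h
  · rw [h, mo.toSyn.injective.eq_iff] at this
    simp [this, hq hq0] at h1
  · rw [h, mo.toSyn.injective.eq_iff] at this
    simp [this, hr hr0] at h2

theorem exists_sub_mem_span_of_degree (hf : mo.degree f = Finsupp.single 0 M)
    (hg : mo.degree g = Finsupp.single 1 N) (hf0 : f ≠ 0) (hg0 : g ≠ 0)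
    (p : MvPolynomial (Fin 2) K) :
    ∃ r ∈ restrictSupport K (exponentBox M N), p - r ∈ Ideal.span {f, g} := by
  obtain ⟨c, r, rfl, -, hr⟩ := mo.div_set (B := {f, g})
    (by rintro b (rfl | rfl) <;> simpa) p
  refine ⟨r, fun s hs => ?_, ?_⟩
  · have h1 := hr s hs f (by simp)
    have h2 := hr s hs g (by simp)
    rw [hf, Finsupp.single_le_iff, not_le] at h1
    rw [hg, Finsupp.single_le_iff, not_le] at h2
    exact ⟨h1, h2⟩
  · rw [add_sub_cancel_right]
    exact Ideal.sum_mem _ fun b _ => Ideal.mul_mem_left _ _ (Ideal.subset_span b.2)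

/-- If the leading monomials of `f` and `g` are `X₀ ^ M` and `X₁ ^ N`, then the monomials
`X₀ ^ i * X₁ ^ j` with `i < M` and `j < N` form a basis of the quotient by `(f, g)`. -/
noncomputable def quotientSpanPairEquiv (hf : mo.degree f = Finsupp.single 0 M)
    (hg : mo.degree g = Finsupp.single 1 N) (hf0 : f ≠ 0) (hg0 : g ≠ 0) :
    restrictSupport K (exponentBox M N) ≃ₗ[K] MvPolynomial (Fin 2) K ⧸ Ideal.span {f, g} :=
  LinearEquiv.ofBijective
    ((Ideal.Quotient.mkₐ K (Ideal.span {f, g})).toLinearMap ∘ₗ Submodule.subtype _) <| by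
    constructor
    · rw [← LinearMap.ker_eq_bot, LinearMap.ker_eq_bot']
      intro p hp
      exact Subtype.ext (eq_zero_of_mem_span_of_mem_restrictSupport hf hg hf0 hg0
        (Ideal.Quotient.eq_zero_iff_mem.1 hp) p.2)
    · intro y
      obtain ⟨p, rfl⟩ := Ideal.Quotient.mk_surjective y
      obtain ⟨r, hr, hpr⟩ := exists_sub_mem_span_of_degree hf hg hf0 hg0 p
      exact ⟨⟨r, hr⟩, (Ideal.Quotient.eq.2 hpr).symm⟩

theorem finite_quotient_span_pair (hf : mo.degree f = Finsupp.single 0 M)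
    (hg : mo.degree g = Finsupp.single 1 N) (hf0 : f ≠ 0) (hg0 : g ≠ 0) :
    Module.Finite K (MvPolynomial (Fin 2) K ⧸ Ideal.span {f, g}) :=
  have := Finite.of_equiv _ (exponentBoxEquiv M N).symm
  Module.Finite.of_basis ((basisRestrictSupport K (exponentBox M N)).map
    (quotientSpanPairEquiv hf hg hf0 hg0))

theorem finrank_quotient_span_pair (hf : mo.degree f = Finsupp.single 0 M)
    (hg : mo.degree g = Finsupp.single 1 N) (hf0 : f ≠ 0) (hg0 : g ≠ 0) :
    Module.finrank K (MvPolynomial (Fin 2) K ⧸ Ideal.span {f, g}) = M * N := by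
  rw [Module.finrank_eq_nat_card_basis ((basisRestrictSupport K (exponentBox M N)).map
    (quotientSpanPairEquiv hf hg hf0 hg0)), Nat.card_congr (exponentBoxEquiv M N)]
  simp

theorem derivation_eq_sum_pderiv {σ A : Type*} [Fintype σ] [AddCommMonoid A] [Module K A]
    [Module (MvPolynomial σ K) A] [IsScalarTower K (MvPolynomial σ K) A]
    (D : Derivation K (MvPolynomial σ K) A) (p : MvPolynomial σ K) :
    D p = ∑ i, pderiv i p • D (X i) := by
  classical
  induction p using MvPolynomial.induction_on with
  | C a => simp [← algebraMap_eq]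
  | add p q hp hq => simp [hp, hq, add_smul, Finset.sum_add_distrib]
  | mul_X p j hp =>
    simp [hp, pderiv_X, add_smul, Finset.sum_add_distrib, Finset.smul_sum, mul_smul,
      Pi.single_apply, mul_comm p, add_comm]

/-- The Jacobian determinant of a pair of polynomials in two variables. -/
noncomputable def jacobianPair {R : Type*} [CommRing R] (f g : MvPolynomial (Fin 2) R) :
    MvPolynomial (Fin 2) R :=
  pderiv 0 f * pderiv 1 g - pderiv 1 f * pderiv 0 g

/-- The quotient by `(f, g)` is unramified where the Jacobian determinant is invertible. -/
theorem formallyUnramified_of_isUnit_jacobianPair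
    (h : IsUnit (Ideal.Quotient.mk (Ideal.span {f, g}) (jacobianPair f g))) :
    Algebra.FormallyUnramified K (MvPolynomial (Fin 2) K ⧸ Ideal.span {f, g}) := by
  set I := Ideal.span {f, g} with hI
  set S := MvPolynomial (Fin 2) K ⧸ I
  let D : Derivation K (MvPolynomial (Fin 2) K) (Ω[S⁄K]) :=
    (KaehlerDifferential.D K S).compAlgebraMap (MvPolynomial (Fin 2) K)
  have hD (p : MvPolynomial (Fin 2) K) :
      D p = KaehlerDifferential.D K S (Ideal.Quotient.mk I p) := rfl
  have hzero (p : MvPolynomial (Fin 2) K) (hp : p ∈ I) :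
      pderiv 0 p • D (X 0) + pderiv 1 p • D (X 1) = 0 := by
    rw [← Fin.sum_univ_two (fun i => pderiv i p • D (X i)), ← derivation_eq_sum_pderiv, hD,
      Ideal.Quotient.eq_zero_iff_mem.2 hp, map_zero]
  have hf := hzero f (Ideal.subset_span (by simp))
  have hg := hzero g (Ideal.subset_span (by simp))
  have hX0 : D (X 0) = 0 := by
    refine (h.smul_eq_zero).1 ?_
    calc jacobianPair f g • D (X 0)
      _ = pderiv 1 g • (pderiv 0 f • D (X 0) + pderiv 1 f • D (X 1)) -
          pderiv 1 f • (pderiv 0 g • D (X 0) + pderiv 1 g • D (X 1)) := by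
        simp only [jacobianPair]
        module
      _ = 0 := by rw [hf, hg, smul_zero, smul_zero, sub_zero]
  have hX1 : D (X 1) = 0 := by
    refine (h.smul_eq_zero).1 ?_
    calc jacobianPair f g • D (X 1)
      _ = pderiv 0 f • (pderiv 0 g • D (X 0) + pderiv 1 g • D (X 1)) -
          pderiv 0 g • (pderiv 0 f • D (X 0) + pderiv 1 f • D (X 1)) := by
        simp only [jacobianPair]
        module
      _ = 0 := by rw [hf, hg, smul_zero, smul_zero, sub_zero]
  refine ⟨subsingleton_of_forall_eq 0 fun y => ?_⟩
  have hy : y ∈ Submodule.span S (range (KaehlerDifferential.D K S)) := by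
    rw [KaehlerDifferential.span_range_derivation]
    trivial
  rw [← Submodule.mem_bot S]
  refine Submodule.span_le.2 ?_ hy
  rintro _ ⟨s, rfl⟩
  obtain ⟨p, rfl⟩ := Ideal.Quotient.mk_surjective s
  rw [← hD, derivation_eq_sum_pderiv D p]
  simp [hX0, hX1]

/-- **Bézout's theorem** for a transverse intersection in the affine plane without intersections
at infinity. -/
theorem ncard_zeros_eq_mul [IsAlgClosed K] (hf : mo.degree f = Finsupp.single 0 M)
    (hg : mo.degree g = Finsupp.single 1 N) (hf0 : f ≠ 0) (hg0 : g ≠ 0)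
    (hJ : ∀ x : Fin 2 → K, aeval x f = 0 → aeval x g = 0 → aeval x (jacobianPair f g) ≠ 0) :
    {x : Fin 2 → K | aeval x f = 0 ∧ aeval x g = 0}.Finite ∧
      {x : Fin 2 → K | aeval x f = 0 ∧ aeval x g = 0}.ncard = M * N := by
  set I := Ideal.span {f, g} with hI
  set S := MvPolynomial (Fin 2) K ⧸ I
  set Z := {x : Fin 2 → K | aeval x f = 0 ∧ aeval x g = 0}
  have hZ : zeroLocus K I = Z := by simp [hI, zeroLocus_span, Z]
  have hfin : Module.Finite K S := finite_quotient_span_pair hf hg hf0 hg0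
  have hunit : IsUnit (Ideal.Quotient.mk I (jacobianPair f g)) := by
    by_contra hu
    obtain ⟨m, hm, hmem⟩ := exists_max_ideal_of_mem_nonunits hu
    have hm' := Ideal.comap_isMaximal_of_surjective (Ideal.Quotient.mk I)
      Ideal.Quotient.mk_surjective (K := m)
    obtain ⟨x, hx⟩ := isMaximal_iff_eq_vanishingIdeal_singleton.1 hm'
    have hIm : ∀ p ∈ I, aeval x p = 0 := fun p hp => by
      rw [← mem_vanishingIdeal_singleton_iff, ← hx, Ideal.mem_comap,
        Ideal.Quotient.eq_zero_iff_mem.2 hp]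
      exact m.zero_mem
    refine hJ x (hIm f (Ideal.subset_span (by simp))) (hIm g (Ideal.subset_span (by simp))) ?_
    rwa [← mem_vanishingIdeal_singleton_iff, ← hx, Ideal.mem_comap]
  have := formallyUnramified_of_isUnit_jacobianPair hunit
  have hred : IsReduced S := Algebra.FormallyUnramified.isReduced_of_field K S
  have hrad : I.IsRadical := (Ideal.isRadical_iff_quotient_reduced I).2 hred
  have hvan : vanishingIdeal K Z = I := by
    rw [← hZ, vanishingIdeal_zeroLocus_eq_radical, hrad.radical]
  let ev (x : Z) : S →ₐ[K] K := Ideal.Quotient.liftₐ I (aeval x.1) fun p hp => by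
    have hx : x.1 ∈ zeroLocus K I := hZ.ge x.2
    exact hx p hp
  have hev (x : Z) (p) : ev x (Ideal.Quotient.mk I p) = aeval x.1 p := rfl
  have hinj : Injective ev := fun x y h => by
    ext i
    simpa [hev] using DFunLike.congr_fun h (Ideal.Quotient.mk I (X i))
  have : Finite (S →ₐ[K] K) := inferInstance
  have hZfin : Finite Z := Finite.of_injective ev hinj
  have hrank : Module.finrank K S = M * N := finrank_quotient_span_pair hf hg hf0 hg0
  rw [← hrank, ← Nat.card_coe_set_eq]
  refine ⟨hZfin, le_antisymm ?_ ?_⟩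
  · exact (Nat.card_le_card_of_injective ev hinj).trans (card_algHom_le_finrank K S K)
  · have : Fintype Z := Fintype.ofFinite Z
    rw [Nat.card_eq_fintype_card, ← Module.finrank_pi K]
    refine LinearMap.finrank_le_finrank_of_injective
      (f := LinearMap.pi fun x => (ev x).toLinearMap) ?_
    rw [← LinearMap.ker_eq_bot, LinearMap.ker_eq_bot']
    intro s hs
    obtain ⟨p, rfl⟩ := Ideal.Quotient.mk_surjective s
    rw [Ideal.Quotient.eq_zero_iff_mem, ← hvan]
    exact fun x hx => congr_fun hs ⟨x, hx⟩

end PlaneIntersection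

section CubicFamily

open MvPolynomial MonomialOrder

/-- The cubic map `z ↦ z³ - 3a²z + (2a³ + v)` over an arbitrary commutative ring. -/
def cubicMap {R : Type*} [CommRing R] (a v z : R) : R :=
  z ^ 3 - 3 * a ^ 2 * z + (2 * a ^ 3 + v)

theorem Fav_eq_cubicMap (a v : ℂ) : Fav a v = cubicMap a v := rfl

theorem map_iterate_cubicMap {R S : Type*} [CommRing R] [CommRing S] (φ : R →+* S) (a v z : R)
    (n : ℕ) : φ ((cubicMap a v)^[n] z) = (cubicMap (φ a) (φ v))^[n] (φ z) :=
  Semiconj.iterate_right (f := φ) (fun z => by simp [cubicMap, map_ofNat φ]) n z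

theorem cubicMap_self {R : Type*} [CommRing R] (a v : R) : cubicMap a v a = v := by
  simp only [cubicMap]; ring

theorem cubicMap_neg_self {R : Type*} [CommRing R] (a v : R) :
    cubicMap a v (-a) = 4 * a ^ 3 + v := by
  simp only [cubicMap]; ring

section LeadingMonomial

variable {K : Type*} [Field K]

theorem single_one_lt_single_zero {n : ℕ} (hn : n ≠ 0) :
    Finsupp.single 1 1 ≺[degLex] Finsupp.single (0 : Fin 2) n :=
  (degLex_single_lt_iff.2 Fin.zero_lt_one).trans_le
    (degLex.toSyn_monotone (Finsupp.single_mono (Nat.one_le_iff_ne_zero.2 hn)))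

theorem single_lt_single_one {i : Fin 2} {n : ℕ} (hn : 1 < n) :
    Finsupp.single i 1 ≺[degLex] Finsupp.single (1 : Fin 2) n := by
  rw [degLex_lt_iff, Finsupp.DegLex.lt_iff]
  exact Or.inl (by simpa)

theorem degree_add_lt {σ R : Type*} [CommSemiring R] {mo : MonomialOrder σ}
    {p q : MvPolynomial σ R} {s : σ →₀ ℕ} (hp : mo.degree p ≺[mo] s)
    (hq : mo.degree q ≺[mo] s) : mo.degree (p + q) ≺[mo] s :=
  mo.degree_add_le.trans_lt (max_lt hp hq)

theorem degree_cubicMap {z : MvPolynomial (Fin 2) K}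
    (h : Finsupp.single 1 1 ≺[degLex] degLex.degree z) :
    degLex.degree (cubicMap (X 1) (X 0) z) = 3 • degLex.degree z := by
  set D := degLex.degree z
  have hpow (n : ℕ) : degLex.toSyn (Finsupp.single (1 : Fin 2) n) =
      n • degLex.toSyn (Finsupp.single (1 : Fin 2) 1) := by
    rw [← map_nsmul, Finsupp.smul_single_one]
  have hD : D ≠ 0 := by
    intro h0
    rw [h0, map_zero] at h
    exact not_lt_bot h
  have heq : cubicMap (X 1) (X 0) z = z ^ 3 + (monomial (Finsupp.single 1 2) (-3) * z +
      (monomial (Finsupp.single 1 3) 2 + X 0)) := by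
    simp only [cubicMap, ← C_mul_X_pow_eq_monomial, map_neg, map_ofNat]
    ring
  rw [heq, degree_add_of_lt, degree_pow]
  rw [degree_pow]
  refine degree_add_lt ?_ (degree_add_lt ?_ ?_)
  · refine degree_mul_le.trans_lt ?_
    rw [map_add, map_nsmul, succ_nsmul _ 2]
    refine add_lt_add_of_lt_of_le ((degree_monomial_le _).trans_lt ?_) le_rfl
    rw [hpow]
    exact nsmul_lt_nsmul_right two_ne_zero h
  · refine (degree_monomial_le _).trans_lt ?_
    rw [hpow, map_nsmul]
    exact nsmul_lt_nsmul_right three_ne_zero h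
  · rw [degree_X, degLex_lt_iff, Finsupp.DegLex.lt_iff]
    left
    have : D.degree ≠ 0 := by rwa [Ne, Finsupp.degree_eq_zero_iff]
    change (Finsupp.single (0 : Fin 2) 1).degree < (3 • D).degree
    rw [Finsupp.degree_single, map_nsmul, smul_eq_mul]
    omega

theorem degree_iterate_cubicMap {z : MvPolynomial (Fin 2) K}
    (h : Finsupp.single 1 1 ≺[degLex] degLex.degree z) (n : ℕ) :
    degLex.degree ((cubicMap (X 1) (X 0))^[n] z) = 3 ^ n • degLex.degree z := by
  induction n with
  | zero => simp
  | succ n ih =>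
    rw [iterate_succ_apply', degree_cubicMap, ih, smul_smul, pow_succ']
    rw [ih, map_nsmul]
    exact h.trans_le (le_self_nsmul (MonomialOrder.zero_le _ _) (by positivity))

theorem degree_iterate_succ_cubicMap_self (n : ℕ) :
    degLex.degree ((cubicMap (X 1) (X 0))^[n + 1] (X 1) : MvPolynomial (Fin 2) K) =
      Finsupp.single 0 (3 ^ n) := by
  rw [iterate_succ_apply, cubicMap_self, degree_iterate_cubicMap, degree_X]
  · simp
  · rw [degree_X, degLex_single_lt_iff]
    simp

theorem degree_iterate_succ_cubicMap_neg_self [CharZero K] (n : ℕ) :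
    degLex.degree ((cubicMap (X 1) (X 0))^[n + 1] (-X 1) : MvPolynomial (Fin 2) K) =
      Finsupp.single 1 (3 ^ (n + 1)) := by
  classical
  have hdeg : degLex.degree (4 * X 1 ^ 3 + X 0 : MvPolynomial (Fin 2) K) =
      Finsupp.single 1 3 := by
    have h4 : (4 * X 1 ^ 3 : MvPolynomial (Fin 2) K) = monomial (Finsupp.single 1 3) 4 := by
      rw [← C_mul_X_pow_eq_monomial, map_ofNat]
    have hmon : degLex.degree (monomial (Finsupp.single 1 3) 4 : MvPolynomial (Fin 2) K) =
        Finsupp.single 1 3 := by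
      rw [degree_monomial, if_neg (by norm_num)]
    rw [h4, degree_add_of_lt, hmon]
    rw [hmon, degree_X]
    exact single_lt_single_one (by norm_num)
  rw [iterate_succ_apply, cubicMap_neg_self, degree_iterate_cubicMap, hdeg]
  · simp [pow_succ]
  · rw [hdeg]
    exact single_lt_single_one (by norm_num)

end LeadingMonomial

theorem exists_pderiv_cubicMap (z : MvPolynomial (Fin 2) ℤ) :
    (∃ H, pderiv 0 (cubicMap (X 1) (X 0) z) = 1 + 3 * H) ∧
      ∃ H, pderiv 1 (cubicMap (X 1) (X 0) z) = 3 * H := by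
  have h3 (i : Fin 2) : pderiv i (3 : MvPolynomial (Fin 2) ℤ) = 0 := by
    simpa using (pderiv_C (i := i) (a := (3 : ℤ)))
  have h2 (i : Fin 2) : pderiv i (2 : MvPolynomial (Fin 2) ℤ) = 0 := by
    simpa using (pderiv_C (i := i) (a := (2 : ℤ)))
  constructor
  · refine ⟨z ^ 2 * pderiv 0 z - X 1 ^ 2 * pderiv 0 z, ?_⟩
    simp [cubicMap, pderiv_X, Derivation.leibniz_pow, h3, h2]
    ring
  · refine ⟨z ^ 2 * pderiv 1 z - X 1 ^ 2 * pderiv 1 z - 2 * X 1 * z + 2 * X 1 ^ 2, ?_⟩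
    simp [cubicMap, pderiv_X, Derivation.leibniz_pow, h3, h2]
    ring

theorem exists_pderiv_iterate_cubicMap (z : MvPolynomial (Fin 2) ℤ) {n : ℕ} (hn : n ≠ 0) :
    (∃ H, pderiv 0 ((cubicMap (X 1) (X 0))^[n] z) = 1 + 3 * H) ∧
      ∃ H, pderiv 1 ((cubicMap (X 1) (X 0))^[n] z) = 3 * H := by
  obtain ⟨n, rfl⟩ := Nat.exists_eq_succ_of_ne_zero hn
  rw [iterate_succ_apply']
  exact exists_pderiv_cubicMap _

theorem exists_valuationSubring_three_mem_nonunits :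
    ∃ V : ValuationSubring ℂ, (3 : ℂ) ∈ V.nonunits := by
  have hne : Ideal.span {(3 : (Int.castRingHom ℂ).range)} ≠ ⊤ := by
    rw [Ne, Ideal.span_singleton_eq_top, isUnit_iff_exists_inv]
    rintro ⟨⟨_, b, rfl⟩, hb⟩
    have hb' : (3 : ℂ) * (b : ℂ) = 1 := congr_arg Subtype.val hb
    norm_cast at hb'
    omega
  obtain ⟨V, -, hV⟩ := Ideal.image_subset_nonunits_valuationSubring _ hne
  exact ⟨V, hV ⟨3, Ideal.subset_span rfl, rfl⟩⟩

section Integrality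

variable {L : Type*} [Field L] {V : ValuationSubring L}

theorem valuation_natCast_le_one (V : ValuationSubring L) (n : ℕ) : V.valuation n ≤ 1 :=
  (V.valuation_le_one_iff _).2 (natCast_mem V n)

theorem valuation_cubicMap {a v z : L} (hz : 1 < V.valuation z)
    (ha : V.valuation a < V.valuation z) (hv : V.valuation v ≤ V.valuation z) :
    V.valuation (cubicMap a v z) = V.valuation z ^ 3 := by
  have hz0 : 0 < V.valuation z := zero_lt_one.trans hz
  have heq : cubicMap a v z = z ^ 3 + (-((3 : ℕ) * (a ^ 2 * z)) + ((2 : ℕ) * a ^ 3 + v)) := by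
    simp only [cubicMap]; push_cast; ring
  have h1 : V.valuation (-((3 : ℕ) * (a ^ 2 * z))) < V.valuation (z ^ 3) := by
    rw [Valuation.map_neg, map_mul]
    refine (mul_le_of_le_one_left' (valuation_natCast_le_one V 3)).trans_lt ?_
    rw [map_mul, map_pow, map_pow, pow_succ _ 2]
    exact mul_lt_mul_of_pos_right (pow_lt_pow_left₀ ha zero_le two_ne_zero) hz0
  have h2 : V.valuation ((2 : ℕ) * a ^ 3) < V.valuation (z ^ 3) := by
    rw [map_mul]
    refine (mul_le_of_le_one_left' (valuation_natCast_le_one V 2)).trans_lt ?_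
    rw [map_pow, map_pow]
    exact pow_lt_pow_left₀ ha zero_le three_ne_zero
  have h3 : V.valuation v < V.valuation (z ^ 3) := by
    rw [map_pow]
    exact hv.trans_lt (lt_self_pow₀ hz (by norm_num))
  rw [heq, Valuation.map_add_eq_of_lt_left _ (Valuation.map_add_lt _ h1
    (Valuation.map_add_lt _ h2 h3)), map_pow]

theorem lt_valuation_iterate_cubicMap {a v z : L} (hz : 1 < V.valuation z)
    (ha : V.valuation a < V.valuation z) (hv : V.valuation v ≤ V.valuation z) (n : ℕ) :
    V.valuation a < V.valuation ((cubicMap a v)^[n] z) := by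
  induction n generalizing z with
  | zero => exact ha
  | succ n ih =>
    have hle : V.valuation z ≤ V.valuation (cubicMap a v z) := by
      rw [valuation_cubicMap hz ha hv]
      exact le_self_pow₀ hz.le three_ne_zero
    exact ih (hz.trans_le hle) (ha.trans_le hle) (hv.trans hle)

theorem mem_of_iterate_cubicMap (h3 : (3 : L) ∈ V.nonunits) {a v : L} {m n : ℕ} (hm : m ≠ 0)
    (hn : n ≠ 0) (h1 : V.valuation ((cubicMap a v)^[m] a) = V.valuation a)
    (h2 : a = 0 ∨ (cubicMap a v)^[n] (-a) = a) : a ∈ V ∧ v ∈ V := by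
  obtain ⟨m, rfl⟩ := Nat.exists_eq_succ_of_ne_zero hm
  obtain ⟨n, rfl⟩ := Nat.exists_eq_succ_of_ne_zero hn
  rw [← V.valuation_le_one_iff, ← V.valuation_le_one_iff]
  rw [iterate_succ_apply, cubicMap_self] at h1
  have hva (hv : 1 < V.valuation v) : V.valuation v ≤ V.valuation a := by
    by_contra! h
    exact (lt_valuation_iterate_cubicMap hv h le_rfl m).ne' h1
  suffices ha : V.valuation a ≤ 1 from
    ⟨ha, not_lt.1 fun hv => (hv.trans_le (hva hv)).not_ge ha⟩
  by_contra! ha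
  have hva' : V.valuation v ≤ V.valuation a := by
    by_contra! h
    exact h.not_ge (hva (ha.trans h))
  rcases h2 with rfl | h2
  · simp at ha
  have h4 : V.valuation (4 : L) = 1 := by
    rw [show (4 : L) = 1 + 3 by norm_num]
    exact Valuation.map_one_add_of_lt _ ((V.mem_nonunits_iff).1 h3)
  have hpow : V.valuation a < V.valuation a ^ 3 := lt_self_pow₀ ha (by norm_num)
  have hval : V.valuation (4 * a ^ 3 + v) = V.valuation a ^ 3 := by
    have h4a : V.valuation (4 * a ^ 3) = V.valuation a ^ 3 := by
      rw [map_mul, map_pow, h4, one_mul]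
    rw [Valuation.map_add_eq_of_lt_left, h4a]
    rw [h4a]
    exact hva'.trans_lt hpow
  rw [iterate_succ_apply, cubicMap_neg_self] at h2
  refine (lt_valuation_iterate_cubicMap (V := V) ?_ ?_ ?_ n).ne' (congr_arg V.valuation h2)
  all_goals rw [hval]
  · exact ha.trans hpow
  · exact hpow
  · exact hva'.trans hpow.le

theorem one_add_three_mul_aeval_ne_zero (h3 : (3 : L) ∈ V.nonunits) {x : Fin 2 → L}
    (hx : ∀ i, x i ∈ V) (H : MvPolynomial (Fin 2) ℤ) : 1 + 3 * aeval x H ≠ 0 := by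
  have hH : aeval x H ∈ V := by
    induction H using MvPolynomial.induction_on with
    | C n => simp
    | add p q hp hq => simpa using add_mem hp hq
    | mul_X p i hp => simpa using mul_mem hp (hx i)
  intro h
  have hlt : V.valuation (3 * aeval x H) < 1 := by
    rw [map_mul]
    exact (mul_le_of_le_one_right' ((V.valuation_le_one_iff _).2 hH)).trans_lt
      ((V.mem_nonunits_iff).1 h3)
  have := Valuation.map_one_add_of_lt _ hlt
  rw [h, map_zero] at this
  exact zero_ne_one this

end Integrality

/-- Parameters whose marked critical point `a` satisfies `F^k(a) = a` and `F^m(a) = -a`. -/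
def periodLocus (m k : ℕ) : Set (ℂ × ℂ) :=
  {w | (Fav w.1 w.2)^[m] w.1 = -w.1 ∧ (Fav w.1 w.2)^[k] w.1 = w.1}

theorem ncard_zeros_eq_mul_of_jacobianPair {f g : MvPolynomial (Fin 2) ℤ} {M N : ℕ}
    (hM : M ≠ 0) (hN : N ≠ 0)
    (hf : degLex.degree (map (Int.castRingHom ℂ) f) = Finsupp.single 0 M)
    (hg : degLex.degree (map (Int.castRingHom ℂ) g) = Finsupp.single 1 N)
    (hJ : ∃ H, jacobianPair f g = 1 + 3 * H)
    (hmem : ∀ (V : ValuationSubring ℂ), 3 ∈ V.nonunits → ∀ x : Fin 2 → ℂ,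
      aeval x f = 0 → aeval x g = 0 → x 1 ∈ V ∧ x 0 ∈ V) :
    {x : Fin 2 → ℂ | aeval x f = 0 ∧ aeval x g = 0}.Finite ∧
      {x : Fin 2 → ℂ | aeval x f = 0 ∧ aeval x g = 0}.ncard = M * N := by
  have haeval (x : Fin 2 → ℂ) (p : MvPolynomial (Fin 2) ℤ) :
      aeval x (map (Int.castRingHom ℂ) p) = aeval x p := aeval_map_algebraMap ℂ x p
  have hf0 : map (Int.castRingHom ℂ) f ≠ 0 :=
    ne_zero_of_degree_ne_zero (m := degLex) (by simpa [hf])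
  have hg0 : map (Int.castRingHom ℂ) g ≠ 0 :=
    ne_zero_of_degree_ne_zero (m := degLex) (by simpa [hg])
  have key := ncard_zeros_eq_mul hf hg hf0 hg0 fun x hxf hxg => by
    rw [haeval] at hxf hxg
    obtain ⟨V, hV⟩ := exists_valuationSubring_three_mem_nonunits
    obtain ⟨h1, h0⟩ := hmem V hV x hxf hxg
    obtain ⟨H, hH⟩ := hJ
    have hmap : jacobianPair (map (Int.castRingHom ℂ) f) (map (Int.castRingHom ℂ) g) =
        map (Int.castRingHom ℂ) (jacobianPair f g) := by
      simp [jacobianPair, pderiv_map]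
    rw [hmap, haeval, hH]
    simpa [map_ofNat (aeval x)] using
      one_add_three_mul_aeval_ne_zero hV (Fin.forall_fin_two.2 ⟨h0, h1⟩) H
  simpa only [haeval] using key

theorem injective_coordSwap : Injective fun x : Fin 2 → ℂ => (x 1, x 0) := fun x y h => by
  ext i
  fin_cases i
  exacts [congr_arg Prod.snd h, congr_arg Prod.fst h]

theorem image_coordSwap (s : Set (Fin 2 → ℂ)) :
    (fun x : Fin 2 → ℂ => (x 1, x 0)) '' s = {w | ![w.2, w.1] ∈ s} := by
  ext w
  constructor
  · rintro ⟨x, hx, rfl⟩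
    have hx' : ![x 0, x 1] = x := by
      ext i
      fin_cases i <;> rfl
    change ![x 0, x 1] ∈ s
    rwa [hx']
  · exact fun hw => ⟨_, hw, rfl⟩

theorem aeval_iterate_cubicMap (x : Fin 2 → ℂ) (z : MvPolynomial (Fin 2) ℤ) (n : ℕ) :
    aeval x ((cubicMap (X 1) (X 0))^[n] z) = (Fav (x 1) (x 0))^[n] (aeval x z) := by
  rw [Fav_eq_cubicMap]
  simpa using map_iterate_cubicMap (aeval x : MvPolynomial (Fin 2) ℤ →ₐ[ℤ] ℂ).toRingHom
    (X 1) (X 0) z n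

theorem periodLocus_zero_finite_ncard {k : ℕ} (hk : 0 < k) :
    (periodLocus 0 k).Finite ∧ (periodLocus 0 k).ncard = 3 ^ (k - 1) := by
  obtain ⟨k, rfl⟩ := Nat.exists_eq_succ_of_ne_zero hk.ne'
  have key := ncard_zeros_eq_mul_of_jacobianPair (M := 3 ^ k) (N := 1)
    (f := (cubicMap (X 1) (X 0))^[k + 1] (X 1) - X 1) (g := X 1) (by positivity) one_ne_zero
    ?_ ?_ ?_ ?_
  · have himage : periodLocus 0 (k + 1) = (fun x : Fin 2 → ℂ => (x 1, x 0)) ''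
        {x | aeval x ((cubicMap (X 1) (X 0))^[k + 1] (X 1) - X 1 : MvPolynomial (Fin 2) ℤ) = 0 ∧
          aeval x (X 1 : MvPolynomial (Fin 2) ℤ) = 0} := by
      rw [image_coordSwap]
      ext w
      simp only [periodLocus, mem_ofPred_eq, map_sub, aeval_X, aeval_iterate_cubicMap,
        sub_eq_zero, iterate_zero, id, self_eq_neg]
      exact and_comm
    rw [himage, ncard_image_of_injective _ injective_coordSwap, key.2]
    exact ⟨key.1.image _, by simp⟩
  · rw [map_sub, map_iterate_cubicMap, map_X, map_X, degree_sub_of_lt] <;>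
      rw [degree_iterate_succ_cubicMap_self]
    rw [degree_X]
    exact single_one_lt_single_zero (by positivity)
  · rw [map_X, degree_X]
  · obtain ⟨⟨H, hH⟩, -⟩ := exists_pderiv_iterate_cubicMap (X 1) (Nat.add_one_ne_zero k)
    exact ⟨H, by simp [-iterate_succ, jacobianPair, hH, pderiv_X]⟩
  · intro V hV x hf hg
    rw [map_sub, aeval_iterate_cubicMap, aeval_X, sub_eq_zero] at hf
    rw [aeval_X] at hg
    exact mem_of_iterate_cubicMap hV (Nat.add_one_ne_zero k) one_ne_zero
      (congr_arg V.valuation hf) (Or.inl hg)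

theorem periodLocus_add_finite_ncard (m n : ℕ) :
    (periodLocus (m + 1) (n + 1 + (m + 1))).Finite ∧
      (periodLocus (m + 1) (n + 1 + (m + 1))).ncard = 3 ^ m * 3 ^ (n + 1) := by
  have key := ncard_zeros_eq_mul_of_jacobianPair (M := 3 ^ m) (N := 3 ^ (n + 1))
    (f := (cubicMap (X 1) (X 0))^[m + 1] (X 1) + X 1)
    (g := (cubicMap (X 1) (X 0))^[n + 1] (-X 1) - X 1) (by positivity) (by positivity)
    ?_ ?_ ?_ ?_
  · have himage : periodLocus (m + 1) (n + 1 + (m + 1)) = (fun x : Fin 2 → ℂ => (x 1, x 0)) ''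
        {x | aeval x ((cubicMap (X 1) (X 0))^[m + 1] (X 1) + X 1 : MvPolynomial (Fin 2) ℤ) = 0 ∧
          aeval x ((cubicMap (X 1) (X 0))^[n + 1] (-X 1) - X 1 : MvPolynomial (Fin 2) ℤ) = 0} := by
      rw [image_coordSwap]
      ext w
      simp only [periodLocus, mem_ofPred_eq, map_add, map_sub, map_neg, aeval_X,
        aeval_iterate_cubicMap, sub_eq_zero, add_eq_zero_iff_eq_neg]
      refine and_congr_right fun h => ?_
      rw [iterate_add_apply, h]
      rfl
    rw [himage, ncard_image_of_injective _ injective_coordSwap, key.2]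
    exact ⟨key.1.image _, rfl⟩
  · rw [map_add, map_iterate_cubicMap, map_X, map_X, degree_add_of_lt] <;>
      rw [degree_iterate_succ_cubicMap_self]
    rw [degree_X]
    exact single_one_lt_single_zero (by positivity)
  · rw [map_sub, map_iterate_cubicMap, map_neg, map_X, map_X, degree_sub_of_lt] <;>
      rw [degree_iterate_succ_cubicMap_neg_self]
    rw [degree_X]
    exact single_lt_single_one (one_lt_pow₀ (by norm_num) (by positivity))
  · obtain ⟨⟨H₁, h₁⟩, H₂, h₂⟩ := exists_pderiv_iterate_cubicMap (X 1) (Nat.add_one_ne_zero m)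
    obtain ⟨⟨H₃, h₃⟩, H₄, h₄⟩ := exists_pderiv_iterate_cubicMap (-X 1) (Nat.add_one_ne_zero n)
    refine ⟨H₄ - H₁ + 3 * H₁ * H₄ - H₂ - H₃ - 3 * H₂ * H₃ - 1, ?_⟩
    simp [-iterate_succ, jacobianPair, h₁, h₂, h₃, h₄, pderiv_X]
    ring
  · intro V hV x hf hg
    rw [map_add, aeval_iterate_cubicMap, aeval_X, add_eq_zero_iff_eq_neg] at hf
    rw [map_sub, aeval_iterate_cubicMap, map_neg, aeval_X, sub_eq_zero] at hg
    exact mem_of_iterate_cubicMap hV (Nat.add_one_ne_zero m) (Nat.add_one_ne_zero n)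
      ((congr_arg V.valuation hf).trans (Valuation.map_neg _ _)) (Or.inr hg)

theorem periodLocus_finite_ncard {m k : ℕ} (hmk : m < k) :
    (periodLocus m k).Finite ∧ (periodLocus m k).ncard = 3 ^ (k - 1) := by
  rcases m with _ | m
  · exact periodLocus_zero_finite_ncard hmk
  · obtain ⟨n, rfl⟩ := Nat.exists_eq_add_of_lt hmk
    have hsum : m + 1 + n + 1 = n + 1 + (m + 1) := by omega
    have hexp : n + 1 + (m + 1) - 1 = m + (n + 1) := by omega
    rw [hsum, hexp, pow_add]
    exact periodLocus_add_finite_ncard m n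

/-- Parameters whose marked critical point `a` has exact period `k` and `F^m(a) = -a`. -/
def exactPeriodLocus (m k : ℕ) : Set (ℂ × ℂ) :=
  {w | (Fav w.1 w.2)^[m] w.1 = -w.1 ∧ minimalPeriod (Fav w.1 w.2) w.1 = k}

theorem exactPeriodLocus_mod (m k : ℕ) : exactPeriodLocus (m % k) k = exactPeriodLocus m k := by
  ext w
  refine and_congr_left ?_
  rintro rfl
  rw [iterate_mod_minimalPeriod_eq]

theorem exactPeriodLocus_subset_periodLocus (m k : ℕ) :
    exactPeriodLocus m k ⊆ periodLocus m k := by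
  rintro w ⟨h, rfl⟩
  exact ⟨h, iterate_minimalPeriod⟩

theorem sum_divisors_ncard_exactPeriodLocus {m k : ℕ} (hmk : m < k) :
    ∑ j ∈ k.divisors, (exactPeriodLocus m j).ncard = 3 ^ (k - 1) := by
  obtain ⟨hfin, hcard⟩ := periodLocus_finite_ncard hmk
  classical
  rw [← hcard, ncard_eq_toFinset_card _ hfin,
    Finset.card_eq_sum_card_fiberwise (f := fun w => minimalPeriod (Fav w.1 w.2) w.1)
      (t := k.divisors)]
  · refine Finset.sum_congr rfl fun j hj => ?_
    rw [← ncard_coe_finset]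
    congr 1
    ext w
    simp only [Finset.coe_filter, Finite.mem_toFinset, mem_ofPred_eq]
    refine ⟨fun hw => ⟨⟨hw.1, ?_⟩, hw.2⟩, fun hw => ⟨hw.1.1, hw.2⟩⟩
    exact (isPeriodicPt_iff_minimalPeriod_dvd).2 (hw.2 ▸ Nat.dvd_of_mem_divisors hj)
  · intro w hw
    have hw := hfin.mem_toFinset.1 hw
    exact Finset.mem_coe.2
      (Nat.mem_divisors.2 ⟨IsPeriodicPt.minimalPeriod_dvd hw.2, by omega⟩)

theorem exactPeriodLocus_finite_ncard {d : ℕ → ℕ}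
    (hd : ∀ n : ℕ, 1 ≤ n → ∑ k ∈ n.divisors, d k = 3 ^ (n - 1)) {k : ℕ} (hk : 1 ≤ k) (m : ℕ) :
    (exactPeriodLocus m k).Finite ∧ (exactPeriodLocus m k).ncard = d k := by
  induction k using Nat.strong_induction_on generalizing m with
  | _ k ih =>
    have hmk : m % k < k := Nat.mod_lt _ hk
    rw [← exactPeriodLocus_mod]
    refine ⟨(periodLocus_finite_ncard hmk).1.subset (exactPeriodLocus_subset_periodLocus _ _), ?_⟩
    have hsum := (sum_divisors_ncard_exactPeriodLocus hmk).trans (hd k hk).symm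
    have hproper : ∑ j ∈ k.properDivisors, (exactPeriodLocus (m % k) j).ncard =
        ∑ j ∈ k.properDivisors, d j := Finset.sum_congr rfl fun j hj => by
      have hj := Nat.mem_properDivisors.1 hj
      exact (ih j hj.2 (Nat.pos_of_dvd_of_pos hj.1 hk) _).2
    rw [← Nat.cons_self_properDivisors (by omega), Finset.sum_cons, Finset.sum_cons,
      hproper] at hsum
    exact Nat.add_right_cancel hsum

theorem hasExactPeriod_iff_minimalPeriod {F : ℂ → ℂ} {z : ℂ} {p : ℕ} (hp : 0 < p) :
    HasExactPeriod F z p ↔ minimalPeriod F z = p := by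
  constructor
  · rintro ⟨h, hlt⟩
    refine le_antisymm (IsPeriodicPt.minimalPeriod_le hp h) ?_
    by_contra! hne
    exact hlt _ (IsPeriodicPt.minimalPeriod_pos hp h) hne iterate_minimalPeriod
  · rintro rfl
    exact ⟨iterate_minimalPeriod, fun j h0 hj =>
      not_isPeriodicPt_of_pos_of_lt_minimalPeriod h0.ne' hj⟩

end CubicFamily

theorem stmt0 (d : ℕ → ℕ) (hd : ∀ n : ℕ, 1 ≤ n → ∑ k ∈ n.divisors, d k = 3 ^ (n - 1))
    (m n : ℕ) (hm : 1 ≤ m) (hn : 1 ≤ n) :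
    let p := m + n
    let B0 : Set (ℂ × ℂ) := {w | (Fav w.1 w.2)^[m] w.1 = -w.1 ∧
      (Fav w.1 w.2)^[n] (-w.1) = w.1 ∧ HasExactPeriod (Fav w.1 w.2) w.1 p}
    B0.Finite ∧ B0.ncard = d p := by
  intro p B0
  have hp : 1 ≤ p := by omega
  have hB0 : B0 = exactPeriodLocus m p := by
    ext w
    simp only [B0, exactPeriodLocus, mem_ofPred_eq, hasExactPeriod_iff_minimalPeriod hp]
    refine and_congr_right fun h => and_iff_right_of_imp fun h' => ?_
    rw [← h, ← iterate_add_apply, add_comm]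
    change (Fav w.1 w.2)^[p] w.1 = w.1
    rw [← h']
    exact iterate_minimalPeriod
  rw [hB0]
  exact exactPeriodLocus_finite_ncard hd hp m
end

section
/- Fix an integer q ≥ 1. The set of angles θ ∈ ℝ/ℤ that are co-periodic of co-period q is finite; it has exactly 4 elements if q = 1, and exactly 6·d(q) elements if q ≥ 2. -/
open Function Set

/-- An angle `θ ∈ ℝ/ℤ` is periodic of exact period `q ≥ 1` under tripling. -/
def ExactPeriodTripling (θ : AddCircle (1 : ℝ)) (q : ℕ) : Prop :=
  (3 ^ q : ℕ) • θ = θ ∧ ∀ j, 0 < j → j < q → (3 ^ j : ℕ) • θ ≠ θ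

/-- An angle `θ ∈ ℝ/ℤ` is co-periodic of co-period `q` if `θ + 1/3` or `θ − 1/3`
is periodic of exact period `q` under tripling. -/
def CoPeriodic (θ : AddCircle (1 : ℝ)) (q : ℕ) : Prop :=
  ExactPeriodTripling (θ + ((1 / 3 : ℝ) : AddCircle (1 : ℝ))) q ∨
  ExactPeriodTripling (θ - ((1 / 3 : ℝ) : AddCircle (1 : ℝ))) q

theorem AddCircle.ncard_nsmul_eq_zero {n : ℕ} (hn : 0 < n) :
    {θ : AddCircle (1 : ℝ) | n • θ = 0}.ncard = n := by
  have : Fact ((0 : ℝ) < 1) := ⟨one_pos⟩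
  have hn' : (0 : ℝ) < n := by exact_mod_cast hn
  have himage : {θ : AddCircle (1 : ℝ) | n • θ = 0} =
      (fun m : ℕ => (((m : ℝ) / n : ℝ) : AddCircle (1 : ℝ))) '' (Finset.range n : Set ℕ) := by
    ext u
    simp [AddCircle.nsmul_eq_zero_iff hn]
  have hmem : ∀ m < n, (m : ℝ) / n ∈ Ico (0 : ℝ) (0 + 1) := fun m hm =>
    ⟨by positivity, by rw [zero_add, div_lt_one hn']; exact_mod_cast hm⟩
  rw [himage, Set.InjOn.ncard_image, Set.ncard_coe_finset, Finset.card_range]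
  intro a ha b hb hab
  simp only [Finset.coe_range, Set.mem_Iio] at ha hb
  have := (AddCircle.coe_eq_coe_iff_of_mem_Ico (hmem a ha) (hmem b hb)).mp hab
  rw [div_left_inj' hn'.ne'] at this
  exact_mod_cast this

theorem isPeriodicPt_tripling_iff (θ : AddCircle (1 : ℝ)) (n : ℕ) :
    IsPeriodicPt (fun x : AddCircle (1 : ℝ) => 3 • x) n θ ↔ (3 ^ n : ℕ) • θ = θ := by
  rw [IsPeriodicPt, IsFixedPt, smul_iterate_apply]

theorem setOf_isPeriodicPt_tripling (n : ℕ) :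
    {θ : AddCircle (1 : ℝ) | IsPeriodicPt (fun x => 3 • x) n θ} = {θ | (3 ^ n - 1) • θ = 0} := by
  ext θ
  have hpow : (3 ^ n : ℕ) • θ = (3 ^ n - 1) • θ + θ := by
    rw [← succ_nsmul, Nat.sub_add_cancel (Nat.one_le_pow _ _ (by lia))]
  simp [isPeriodicPt_tripling_iff, hpow]

theorem three_pow_sub_one_pos {n : ℕ} (hn : 1 ≤ n) : 0 < 3 ^ n - 1 :=
  Nat.sub_pos_of_lt (Nat.one_lt_pow (by lia) (by lia))

theorem exactPeriodTripling_iff (θ : AddCircle (1 : ℝ)) {q : ℕ} (hq : 1 ≤ q) :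
    ExactPeriodTripling θ q ↔ minimalPeriod (fun x => 3 • x) θ = q := by
  simp only [ExactPeriodTripling, ne_eq, ← isPeriodicPt_tripling_iff]
  constructor
  · rintro ⟨hper, hmin⟩
    refine le_antisymm (hper.minimalPeriod_le hq) (not_lt.mp fun hlt => ?_)
    exact hmin _ (hper.minimalPeriod_pos hq) hlt (isPeriodicPt_minimalPeriod _ _)
  · rintro rfl
    exact ⟨isPeriodicPt_minimalPeriod _ _, fun j hj hlt hper =>
      (hper.minimalPeriod_le hj).not_gt hlt⟩

theorem finite_setOf_exactPeriodTripling {q : ℕ} (hq : 1 ≤ q) :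
    {θ | ExactPeriodTripling θ q}.Finite := by
  have : Fact ((0 : ℝ) < 1) := ⟨one_pos⟩
  refine (AddCircle.finite_torsion (1 : ℝ) (three_pow_sub_one_pos hq)).subset fun θ hθ => ?_
  rw [← setOf_isPeriodicPt_tripling]
  exact (isPeriodicPt_tripling_iff θ q).mpr hθ.1

theorem sum_divisors_ncard_exactPeriodTripling {n : ℕ} (hn : 1 ≤ n) :
    ∑ k ∈ n.divisors, {θ | ExactPeriodTripling θ k}.ncard = 3 ^ n - 1 := by
  classical
  have : Fact ((0 : ℝ) < 1) := ⟨one_pos⟩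
  have hfin : {θ : AddCircle (1 : ℝ) | IsPeriodicPt (fun x => 3 • x) n θ}.Finite := by
    rw [setOf_isPeriodicPt_tripling]
    exact AddCircle.finite_torsion (1 : ℝ) (three_pow_sub_one_pos hn)
  rw [← AddCircle.ncard_nsmul_eq_zero (three_pow_sub_one_pos hn), ← setOf_isPeriodicPt_tripling,
    Set.ncard_eq_toFinset_card _ hfin, Finset.card_eq_sum_card_fiberwise
      (f := minimalPeriod (fun x : AddCircle (1 : ℝ) => 3 • x)) (t := n.divisors)]
  · refine Finset.sum_congr rfl fun k hk => ?_
    rw [← Set.ncard_coe_finset]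
    congr 1
    ext θ
    have hkpos := Nat.pos_of_mem_divisors hk
    simp only [Set.mem_ofPred_eq, Finset.coe_filter, Set.Finite.mem_toFinset,
      exactPeriodTripling_iff θ hkpos]
    refine ⟨fun h => ⟨?_, h⟩, And.right⟩
    rw [isPeriodicPt_iff_minimalPeriod_dvd, h]
    exact Nat.dvd_of_mem_divisors hk
  · intro θ hθ
    have hper : IsPeriodicPt (fun x => 3 • x) n θ := by simpa using hθ
    simpa using ⟨hper.minimalPeriod_dvd, by lia⟩

theorem eq_of_sum_divisors_eq {f g : ℕ → ℕ}
    (h : ∀ n, 1 ≤ n → ∑ k ∈ n.divisors, f k = ∑ k ∈ n.divisors, g k) {n : ℕ} (hn : 1 ≤ n) :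
    f n = g n := by
  induction n using Nat.strong_induction_on with
  | _ n ih =>
    have hsum := h n hn
    have hproper : ∑ k ∈ n.properDivisors, f k = ∑ k ∈ n.properDivisors, g k :=
      Finset.sum_congr rfl fun k hk =>
        ih k (Nat.mem_properDivisors.mp hk).2 (Nat.pos_of_mem_properDivisors hk)
    rw [← Nat.cons_self_properDivisors (by lia), Finset.sum_cons, Finset.sum_cons,
      hproper] at hsum
    exact Nat.add_right_cancel hsum

theorem ncard_exactPeriodTripling (d : ℕ → ℕ)
    (hd : ∀ n : ℕ, 1 ≤ n → ∑ k ∈ n.divisors, d k = 3 ^ (n - 1)) {q : ℕ} (hq : 1 ≤ q) :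
    {θ | ExactPeriodTripling θ q}.ncard + (if q = 1 then 1 else 0) = 3 * d q := by
  refine eq_of_sum_divisors_eq
    (f := fun q => {θ | ExactPeriodTripling θ q}.ncard + if q = 1 then 1 else 0)
    (g := fun q => 3 * d q) (fun n hn => ?_) hq
  rw [Finset.sum_add_distrib, sum_divisors_ncard_exactPeriodTripling hn, ← Finset.mul_sum, hd n hn,
    Finset.sum_ite_eq', if_pos (Nat.one_mem_divisors.mpr (by lia)), ← pow_succ',
    Nat.sub_add_cancel hn, Nat.sub_add_cancel (Nat.one_le_pow _ _ (by lia))]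

theorem nsmul_one_third {q : ℕ} (hq : 1 ≤ q) :
    (3 ^ q : ℕ) • ((1 / 3 : ℝ) : AddCircle (1 : ℝ)) = 0 := by
  obtain ⟨m, rfl⟩ := Nat.exists_eq_add_of_le' hq
  rw [← AddCircle.coe_nsmul, AddCircle.coe_eq_zero_iff]
  refine ⟨3 ^ m, ?_⟩
  simp [pow_succ]

theorem one_third_ne_neg_one_third :
    ((1 / 3 : ℝ) : AddCircle (1 : ℝ)) ≠ -((1 / 3 : ℝ) : AddCircle (1 : ℝ)) := by
  rw [ne_eq, eq_neg_iff_add_eq_zero, ← AddCircle.coe_add, AddCircle.coe_eq_zero_iff]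
  rintro ⟨n, hn⟩
  have h : (3 * n : ℝ) = 2 := by
    rw [zsmul_eq_mul] at hn
    linarith
  have h' : 3 * n = 2 := by exact_mod_cast h
  lia

theorem ncard_coPeriodic {q : ℕ} (hq : 1 ≤ q) :
    {θ | CoPeriodic θ q}.Finite ∧
      {θ | CoPeriodic θ q}.ncard = 2 * {θ | ExactPeriodTripling θ q}.ncard := by
  set t : AddCircle (1 : ℝ) := ((1 / 3 : ℝ) : AddCircle (1 : ℝ)) with ht
  set P := {θ | ExactPeriodTripling θ q} with hP
  have hfin : P.Finite := finite_setOf_exactPeriodTripling hq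
  have hunion : {θ | CoPeriodic θ q} = (fun θ => θ - t) '' P ∪ (fun θ => θ + t) '' P := by
    ext θ
    change ExactPeriodTripling (θ + t) q ∨ ExactPeriodTripling (θ - t) q ↔ _
    simp [hP, sub_eq_add_neg]
  have hdisj : Disjoint ((fun θ => θ - t) '' P) ((fun θ => θ + t) '' P) := by
    rw [Set.disjoint_left]
    rintro _ ⟨a, ha, rfl⟩ ⟨b, hb, hab⟩
    have hab' : b + t = a - t := hab
    have hiter := congrArg (fun x => (3 ^ q : ℕ) • x) hab'
    simp only [nsmul_add, nsmul_sub, ha.1, hb.1, ht, nsmul_one_third hq, add_zero,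
      sub_zero] at hiter
    rw [hiter, sub_eq_add_neg] at hab'
    exact one_third_ne_neg_one_third (add_left_cancel hab')
  rw [hunion]
  refine ⟨(hfin.image _).union (hfin.image _), ?_⟩
  rw [Set.ncard_union_eq hdisj (hfin.image _) (hfin.image _),
    Set.ncard_image_of_injective _ sub_left_injective,
    Set.ncard_image_of_injective _ (add_left_injective t), two_mul]

theorem stmt7 (d : ℕ → ℕ) (hd : ∀ n : ℕ, 1 ≤ n → ∑ k ∈ n.divisors, d k = 3 ^ (n - 1))
    (q : ℕ) (hq : 1 ≤ q) :
    let C : Set (AddCircle (1 : ℝ)) := {θ | CoPeriodic θ q}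
    C.Finite ∧ (q = 1 → C.ncard = 4) ∧ (2 ≤ q → C.ncard = 6 * d q) := by
  intro C
  obtain ⟨hfin, hcard⟩ := ncard_coPeriodic hq
  have hP := ncard_exactPeriodTripling d hd hq
  refine ⟨hfin, fun h => ?_, fun h => ?_⟩
  · subst h
    have hd1 : d 1 = 1 := by simpa using hd 1 le_rfl
    rw [if_pos rfl, hd1] at hP
    lia
  · rw [if_neg (by lia)] at hP
    lia
end

section
/- Let d : ℕ → ℕ satisfy the recursion ∑_{k ∣ n} d(k) = 3^{n−1} for every n ≥ 1. Then |d(p) − 3^{p−1}| ≤ 3^{⌊p/2⌋} for every p ≥ 1; in particular d(p)/3^{p−1} tends to 1 as p → ∞, i.e., d(p) is asymptotic to 3^{p−1}. -/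
open Filter

lemma sum_properDivisors_le_three_pow (d : ℕ → ℕ)
    (hd : ∀ n : ℕ, 1 ≤ n → ∑ k ∈ n.divisors, d k = 3 ^ (n - 1)) (p : ℕ) :
    ∑ k ∈ p.properDivisors, d k ≤ 3 ^ (p / 2) := by
  have hle (n : ℕ) (hn : 1 ≤ n) : d n ≤ 3 ^ (n - 1) := by
    rw [← hd n hn]
    exact Finset.single_le_sum (f := d) (fun _ _ => Nat.zero_le _)
      (Nat.mem_divisors_self n (by omega))
  have hsub : p.properDivisors ⊆ (Finset.range (p / 2)).image (· + 1) := by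
    intro k hk
    obtain ⟨⟨c, rfl⟩, hlt⟩ := Nat.mem_properDivisors.1 hk
    have hk0 : 0 < k := Nat.pos_of_mem_properDivisors hk
    have hc : 2 ≤ c := by
      by_contra! h
      interval_cases c <;> omega
    have hk2 : k ≤ k * c / 2 := (Nat.le_div_iff_mul_le two_pos).2 (Nat.mul_le_mul_left k hc)
    exact Finset.mem_image.2 ⟨k - 1, Finset.mem_range.2 (by omega), by omega⟩
  calc ∑ k ∈ p.properDivisors, d k
      ≤ ∑ k ∈ (Finset.range (p / 2)).image (· + 1), d k := Finset.sum_le_sum_of_subset hsub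
    _ = ∑ k ∈ Finset.range (p / 2), d (k + 1) :=
        Finset.sum_image fun _ _ _ _ h => Nat.succ_injective h
    _ ≤ ∑ k ∈ Finset.range (p / 2), 3 ^ k :=
        Finset.sum_le_sum fun k _ => hle (k + 1) (by omega)
    _ ≤ 3 ^ (p / 2) :=
        (Nat.geomSum_lt (by norm_num) fun _ h => Finset.mem_range.1 h).le

theorem stmt18 (d : ℕ → ℕ) (hd : ∀ n : ℕ, 1 ≤ n → ∑ k ∈ n.divisors, d k = 3 ^ (n - 1)) :
    (∀ p : ℕ, 1 ≤ p → |(d p : ℤ) - 3 ^ (p - 1)| ≤ 3 ^ (p / 2)) ∧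
    Tendsto (fun p : ℕ => (d p : ℝ) / 3 ^ (p - 1)) atTop (nhds 1) := by
  have hbound (p : ℕ) (hp : 1 ≤ p) : |(d p : ℤ) - 3 ^ (p - 1)| ≤ 3 ^ (p / 2) := by
    have hsum := hd p hp
    rw [← Nat.insert_self_properDivisors (by omega),
      Finset.sum_insert Nat.self_notMem_properDivisors] at hsum
    have hle := sum_properDivisors_le_three_pow d hd p
    zify at hsum hle
    have hnonneg : (0 : ℤ) ≤ ∑ k ∈ p.properDivisors, (d k : ℤ) :=
      Finset.sum_nonneg fun _ _ => Int.natCast_nonneg _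
    rw [abs_le]
    constructor <;> linarith
  refine ⟨hbound, ?_⟩
  have hhalf : Tendsto (fun p : ℕ => (p - 1) / 2) atTop atTop :=
    (Nat.tendsto_div_const_atTop two_ne_zero).comp (tendsto_sub_atTop_nat 1)
  have hlim : Tendsto (fun p : ℕ => (1 / 3 : ℝ) ^ ((p - 1) / 2)) atTop (nhds 0) :=
    (tendsto_pow_atTop_nhds_zero_of_lt_one (by norm_num) (by norm_num)).comp hhalf
  rw [tendsto_iff_dist_tendsto_zero]
  refine squeeze_zero' (Eventually.of_forall fun _ => dist_nonneg) ?_ hlim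
  filter_upwards [eventually_ge_atTop 1] with p hp
  have h : |(d p : ℝ) - 3 ^ (p - 1)| ≤ 3 ^ (p / 2) := by exact_mod_cast hbound p hp
  have hpos : (0 : ℝ) < 3 ^ (p - 1) := by positivity
  rw [Real.dist_eq, div_sub_one hpos.ne', abs_div, abs_of_pos hpos, div_le_iff₀ hpos]
  refine h.trans_eq ?_
  have hexp : p - 1 = (p - 1) / 2 + p / 2 := by omega
  conv_rhs => rw [hexp, pow_add, ← hexp, ← mul_assoc, ← mul_pow]
  norm_num
end
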